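/- arXiv:1712.08699 — 2 statements merged into one kernel-verified Lean document; each statement's English description precedes it below -/
import Mathlib

section
/- For every finite bipartite graph G and every positive integer w, the value of the token game satisfies f(w,G) = w. -/
/-!  Common definitions: the online token-coloring game of Milans–Wigal. -/

/-- Tokens `i` and `j` of the play `s` (Spoiler's `i`-th move is at vertex `s i`) are
adjacent in the token graph: they are distinct tokens lying on the same vertex or on
adjacent vertices of `G`. -/
def TokenAdj {V : Type*} (G : SimpleGraph V) (s : ℕ → V) (i j : ℕ) : Prop :=
  i ≠ j ∧ (s i = s j ∨ G.Adj (s i) (s j))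

/-- The play consisting of the first `n` tokens of `s` is legal for Spoiler in the game of
width `w`: the token graph on these `n` tokens has chromatic number at most `w`. -/
def LegalPlay {V : Type*} (G : SimpleGraph V) (w : ℕ) (s : ℕ → V) (n : ℕ) : Prop :=
  ∃ φ : ℕ → ℕ, (∀ i, i < n → φ i < w) ∧
    ∀ i j, i < n → j < n → TokenAdj G s i j → φ i ≠ φ j

/-- The color that Algorithm's (deterministic, online) strategy `σ` assigns to the `i`-th
token of the play `s`: `σ` is applied to the history of Spoiler's moves up to and
including the `i`-th one. -/
def colorOf {V : Type*} (σ : List V → ℕ) (s : ℕ → V) (i : ℕ) : ℕ :=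
  σ (List.ofFn fun j : Fin (i + 1) => s j)

/-- Strategy `σ` for Algorithm wins the token game on `G` of width `w` using at most `k`
colors: against every legal Spoiler play, all assigned colors lie in `{0, …, k-1}` and the
resulting coloring of the token graph is proper. -/
def AlgWins {V : Type*} (G : SimpleGraph V) (w k : ℕ) (σ : List V → ℕ) : Prop :=
  ∀ (n : ℕ) (s : ℕ → V), LegalPlay G w s n →
    (∀ i, i < n → colorOf σ s i < k) ∧
    ∀ i j, i < n → j < n → TokenAdj G s i j → colorOf σ s i ≠ colorOf σ s j

/-- `gameValue G w` is the value `f(w, G)` of the token game on `G` of width `w`: the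
minimum number of colors with which Algorithm has a winning strategy. -/
noncomputable def gameValue {V : Type*} (G : SimpleGraph V) (w : ℕ) : ℕ :=
  sInf {k | ∃ σ : List V → ℕ, AlgWins G w k σ}

/-- The number of tokens placed before the `i`-th one on the same vertex. -/
noncomputable def tokenRank {V : Type*} (s : ℕ → V) (i : ℕ) : ℕ :=
  open Classical in {j ∈ Finset.range i | s j = s i}.card

/-- The tokens up to the `i`-th one lying on the same vertex as it. -/
noncomputable def tokenStack {V : Type*} (s : ℕ → V) (i : ℕ) : Finset ℕ :=
  open Classical in {j ∈ Finset.range (i + 1) | s j = s i}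

theorem mem_tokenStack {V : Type*} {s : ℕ → V} {i j : ℕ} :
    j ∈ tokenStack s i ↔ j ≤ i ∧ s j = s i := by
  simp [tokenStack]

theorem card_tokenStack {V : Type*} (s : ℕ → V) (i : ℕ) :
    (tokenStack s i).card = tokenRank s i + 1 := by
  classical
  simp [tokenStack, tokenRank, Finset.range_add_one, Finset.filter_insert]

theorem tokenRank_lt_tokenRank {V : Type*} {s : ℕ → V} {i j : ℕ} (hij : i < j)
    (h : s i = s j) : tokenRank s i < tokenRank s j := by
  classical
  rw [← Nat.succ_le_iff, Nat.succ_eq_add_one, ← card_tokenStack, tokenRank]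
  refine Finset.card_le_card fun x hx => ?_
  rw [mem_tokenStack] at hx
  simp only [Finset.mem_filter, Finset.mem_range]
  exact ⟨by omega, hx.2.trans h⟩

theorem count_ofFn_eq_card_filter {V : Type*} [DecidableEq V] (s : ℕ → V) (a : V) (n : ℕ) :
    (List.ofFn fun j : Fin n => s j).count a = {j ∈ Finset.range n | s j = a}.card := by
  induction n with
  | zero => simp
  | succ n ih =>
    rw [List.ofFn_succ_last, List.count_append, Finset.range_add_one, Finset.filter_insert]
    simp only [Fin.val_castSucc, Fin.val_last, ih, List.count_singleton, beq_iff_eq]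
    split_ifs <;> simp

/-- A clique of the token graph of a legal play has at most `w` tokens. -/
theorem LegalPlay.card_le {V : Type*} {G : SimpleGraph V} {w : ℕ} {s : ℕ → V} {n : ℕ}
    (h : LegalPlay G w s n) (T : Finset ℕ) (hT : ∀ i ∈ T, i < n)
    (hadj : ∀ i ∈ T, ∀ j ∈ T, i ≠ j → s i = s j ∨ G.Adj (s i) (s j)) : T.card ≤ w := by
  obtain ⟨φ, hφ, hne⟩ := h
  rw [← Finset.card_range w]
  refine Finset.card_le_card_of_injOn φ (fun i hi => by simpa using hφ i (hT i hi)) ?_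
  intro i hi j hj hij
  by_contra hn
  exact hne i j (hT i hi) (hT j hj) ⟨hn, hadj i hi j hj hn⟩ hij

theorem LegalPlay.tokenRank_lt {V : Type*} {G : SimpleGraph V} {w : ℕ} {s : ℕ → V} {n : ℕ}
    (h : LegalPlay G w s n) {i : ℕ} (hi : i < n) : tokenRank s i < w := by
  have := h.card_le (tokenStack s i) (fun x hx => (mem_tokenStack.1 hx).1.trans_lt hi)
    fun x hx y hy _ => .inl ((mem_tokenStack.1 hx).2.trans (mem_tokenStack.1 hy).2.symm)
  rw [card_tokenStack] at this
  omega

theorem LegalPlay.tokenRank_add_tokenRank {V : Type*} {G : SimpleGraph V} {w : ℕ} {s : ℕ → V}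
    {n : ℕ} (h : LegalPlay G w s n) {i j : ℕ} (hi : i < n) (hj : j < n)
    (hij : G.Adj (s i) (s j)) : tokenRank s i + 1 + (tokenRank s j + 1) ≤ w := by
  classical
  rw [← card_tokenStack, ← card_tokenStack, ← Finset.card_union_of_disjoint]
  · refine h.card_le _ (fun x hx => ?_) fun x hx y hy _ => ?_
    · rw [Finset.mem_union, mem_tokenStack, mem_tokenStack] at hx
      omega
    · rw [Finset.mem_union, mem_tokenStack, mem_tokenStack] at hx hy
      rcases hx with ⟨-, hx⟩ | ⟨-, hx⟩ <;> rcases hy with ⟨-, hy⟩ | ⟨-, hy⟩ <;>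
        simp [hx, hy, hij, hij.symm]
  · rw [Finset.disjoint_left]
    intro x hx hy
    exact hij.ne ((mem_tokenStack.1 hx).2.symm.trans (mem_tokenStack.1 hy).2)

/-- Given a 2-coloring `c` of the board, the strategy that uses the colors `0, 1, …` in
increasing order on the vertices of class `0`, and `w - 1, w - 2, …` in decreasing order on
the vertices of the other class. -/
noncomputable def twoSidedStrategy {V : Type*} (c : V → Fin 2) (w : ℕ) (l : List V) : ℕ :=
  open Classical in
  match l.getLast? with
  | none => 0
  | some v => if c v = 0 then l.dropLast.count v else w - 1 - l.dropLast.count v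

theorem colorOf_twoSidedStrategy {V : Type*} (c : V → Fin 2) (w : ℕ) (s : ℕ → V) (i : ℕ) :
    colorOf (twoSidedStrategy c w) s i =
      if c (s i) = 0 then tokenRank s i else w - 1 - tokenRank s i := by
  classical
  simp only [colorOf, twoSidedStrategy, List.ofFn_succ_last, List.getLast?_concat,
    List.dropLast_concat, Fin.val_castSucc, Fin.val_last, count_ofFn_eq_card_filter, tokenRank]

theorem algWins_twoSidedStrategy {V : Type*} {G : SimpleGraph V} (c : G.Coloring (Fin 2))
    (w : ℕ) : AlgWins G w w (twoSidedStrategy c w) := by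
  refine fun n s h => ⟨fun i hi => ?_, fun i j hi hj hij => ?_⟩
  · have := h.tokenRank_lt hi
    rw [colorOf_twoSidedStrategy]
    split_ifs <;> omega
  · have hri := h.tokenRank_lt hi
    have hrj := h.tokenRank_lt hj
    rw [colorOf_twoSidedStrategy, colorOf_twoSidedStrategy]
    obtain ⟨hne, heq | hadj⟩ := hij
    · have hr : tokenRank s i ≠ tokenRank s j := by
        rcases hne.lt_or_gt with hlt | hlt
        · exact (tokenRank_lt_tokenRank hlt heq).ne
        · exact (tokenRank_lt_tokenRank hlt heq.symm).ne'
      rw [heq]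
      split_ifs <;> omega
    · have hsum := h.tokenRank_add_tokenRank hi hj hadj
      have hc := c.valid hadj
      split_ifs <;> omega

theorem AlgWins.le {V : Type*} [Nonempty V] {G : SimpleGraph V} {w k : ℕ} {σ : List V → ℕ}
    (h : AlgWins G w k σ) : w ≤ k := by
  obtain ⟨v⟩ := ‹Nonempty V›
  obtain ⟨hlt, hne⟩ := h w (fun _ => v) ⟨id, fun _ hi => hi, fun _ _ _ _ hij => hij.1⟩
  rw [← Finset.card_range w, ← Finset.card_range k]
  refine Finset.card_le_card_of_injOn (colorOf σ fun _ => v)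
    (fun i hi => by simpa using hlt i (by simpa using hi)) fun i hi j hj hij => ?_
  by_contra hn
  exact hne i j (by simpa using hi) (by simpa using hj) ⟨hn, .inl rfl⟩ hij

/-- For every finite bipartite graph `G` and every positive integer `w`, the value of the
token game satisfies `f(w, G) = w`. -/
theorem bipartite_gameValue {V : Type} [Fintype V] [Nonempty V] (G : SimpleGraph V)
    (hG : G.Colorable 2) (w : ℕ) (hw : 0 < w) :
    gameValue G w = w := by
  obtain ⟨c⟩ := hG
  have hmem : w ∈ {k | ∃ σ : List V → ℕ, AlgWins G w k σ} :=
    ⟨_, algWins_twoSidedStrategy c w⟩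
  refine le_antisymm (Nat.sInf_le hmem) (le_csInf ⟨w, hmem⟩ ?_)
  rintro k ⟨σ, hσ⟩
  exact hσ.le
end

section
/- For every finite graph G, one has f(2,G) = 2 if and only if G contains no induced subgraph isomorphic to any of the following: an odd cycle C_n with n ≥ 5, the graph C_5^+ (a 5-cycle with one chord added), the graph P_5^2 (the square of the 5-vertex path, equivalently a 5-cycle with two non-crossing chords), or the bull graph B (a triangle with two pendant edges attached at distinct triangle vertices). -/
/-- `C₅⁺`: the 5-cycle with one added chord, equivalently the complement of the path
`P₅` on 5 vertices. -/
def C5plus : SimpleGraph (Fin 5) := (SimpleGraph.pathGraph 5)ᶜ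

/-- `P₅²`: the square (distance-2 power) of the path on 5 vertices: vertices `0,…,4`,
adjacent iff distinct and at distance at most 2 along the path. -/
def P5sq : SimpleGraph (Fin 5) :=
  SimpleGraph.fromRel (fun i j : Fin 5 => i.val ≤ j.val + 2 ∧ j.val ≤ i.val + 2)

/-- The bull graph: a triangle `0,1,2` with pendant vertices `3` (adjacent to `0`) and
`4` (adjacent to `1`). -/
def bullGraph : SimpleGraph (Fin 5) :=
  SimpleGraph.fromRel (fun i j : Fin 5 =>
    (i = 0 ∧ j = 1) ∨ (i = 1 ∧ j = 2) ∨ (i = 0 ∧ j = 2) ∨ (i = 0 ∧ j = 3) ∨ (i = 1 ∧ j = 4))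

/-- `G` contains an induced copy of one of the forbidden graphs: an odd cycle `Cₙ` with
`n ≥ 5`, the graph `C₅⁺`, the graph `P₅²`, or the bull graph. -/
def HasObstruction {V : Type*} (G : SimpleGraph V) : Prop :=
  (∃ n : ℕ, 5 ≤ n ∧ Odd n ∧ Nonempty (SimpleGraph.cycleGraph n ↪g G)) ∨
    Nonempty (C5plus ↪g G) ∨ Nonempty (P5sq ↪g G) ∨ Nonempty (bullGraph ↪g G)

theorem gameValue_two_iff_exists_algWins {V : Type*} [Nonempty V] (G : SimpleGraph V) :
    gameValue G 2 = 2 ↔ ∃ σ : List V → ℕ, AlgWins G 2 2 σ := by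
  unfold gameValue
  constructor
  · intro h
    have hne : {k | ∃ σ : List V → ℕ, AlgWins G 2 k σ}.Nonempty := by
      by_contra hcon
      rw [Set.not_nonempty_iff_eq_empty] at hcon
      simp [hcon] at h
    have hmem := Nat.sInf_mem hne
    rw [h] at hmem
    exact hmem
  · rintro ⟨σ, hσ⟩
    have hmem : 2 ∈ {k | ∃ σ : List V → ℕ, AlgWins G 2 k σ} := ⟨σ, hσ⟩
    refine le_antisymm (Nat.sInf_le hmem) ?_
    obtain ⟨τ, hτ⟩ := Nat.sInf_mem ⟨2, hmem⟩
    obtain ⟨v⟩ := ‹Nonempty V›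
    have hlegal : LegalPlay G 2 (fun _ => v) 2 :=
      ⟨id, fun i hi => hi, fun i j _ _ hij => hij.1⟩
    obtain ⟨hlt, hprop⟩ := hτ 2 _ hlegal
    have h0 := hlt 0 (by omega)
    have h1 := hlt 1 (by omega)
    have h01 := hprop 0 1 (by omega) (by omega) ⟨by omega, Or.inl rfl⟩
    omega

/-! ### Spoiler's strategies -/

theorem AlgWins.comap {V W : Type*} {H : SimpleGraph W} {G : SimpleGraph V} (e : H ↪g G)
    {w k : ℕ} {σ : List V → ℕ} (h : AlgWins G w k σ) :
    AlgWins H w k fun l => σ (l.map e) := by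
  intro n s hs
  have hadj : ∀ i j, TokenAdj G (e ∘ s) i j ↔ TokenAdj H s i j := by
    intro i j
    simp [TokenAdj]
  have hcol : ∀ i, colorOf (fun l => σ (l.map e)) s i = colorOf σ (e ∘ s) i := by
    intro i
    simp [colorOf, List.map_ofFn, Function.comp_def]
  obtain ⟨φ, hφ, hφ'⟩ := hs
  have := h n (e ∘ s) ⟨φ, hφ, fun i j hi hj hij => hφ' i j hi hj ((hadj i j).1 hij)⟩
  simpa only [hcol, hadj] using this

theorem colorOf_congr {V : Type*} (σ : List V → ℕ) {s t : ℕ → V} {i : ℕ}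
    (h : ∀ j ≤ i, s j = t j) : colorOf σ s i = colorOf σ t i := by
  unfold colorOf
  congr 2
  funext j
  exact h j (by omega)

/-- A play whose token graph is properly colored by an explicit finite list is legal. -/
theorem legalPlay_of_list {V : Type*} {G : SimpleGraph V} {w : ℕ} {s : ℕ → V} {n : ℕ}
    (l : List ℕ) (h : ∀ i < n, l.getD i 0 < w)
    (h' : ∀ i < n, ∀ j < n, TokenAdj G s i j → l.getD i 0 ≠ l.getD j 0) : LegalPlay G w s n :=
  ⟨fun i => l.getD i 0, h, fun i j hi hj => h' i hi j hj⟩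

/-- Spoiler wins if, after the tokens `a` and `b`, the remaining path of length two forces
equal colors on them while the remaining path of length three forces different colors. -/
theorem not_algWins_of_even_odd_paths {V : Type*} [DecidableEq V] {G : SimpleGraph V}
    {a b c d e : V} (hac : G.Adj a c) (hcb : G.Adj c b) (had : G.Adj a d) (hde : G.Adj d e)
    (heb : G.Adj e b) (hab : ¬ G.Adj a b) (hab' : a ≠ b) (hae : ¬ G.Adj a e) (hae' : a ≠ e)
    (hdb : ¬ G.Adj d b) (hdb' : d ≠ b) (σ : List V → ℕ) : ¬ AlgWins G 2 2 σ := by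
  intro h
  let s : ℕ → V := fun i => if i = 0 then a else if i = 1 then b else c
  let t : ℕ → V := fun i => if i = 0 then a else if i = 1 then b else if i = 2 then d else e
  have hs : LegalPlay G 2 s 3 := by
    refine legalPlay_of_list [0, 0, 1] (by decide) ?_
    intro i hi j hj
    interval_cases i <;> interval_cases j <;>
      simp_all [TokenAdj, s, G.adj_comm, eq_comm]
  have ht : LegalPlay G 2 t 4 := by
    refine legalPlay_of_list [0, 1, 1, 0] (by decide) ?_
    intro i hi j hj
    interval_cases i <;> interval_cases j <;>
      simp_all [TokenAdj, t, G.adj_comm, eq_comm]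
  obtain ⟨hs1, hs2⟩ := h _ _ hs
  obtain ⟨ht1, ht2⟩ := h _ _ ht
  have e0 : colorOf σ s 0 = colorOf σ t 0 :=
    colorOf_congr σ fun j hj => by interval_cases j; rfl
  have e1 : colorOf σ s 1 = colorOf σ t 1 :=
    colorOf_congr σ fun j hj => by interval_cases j <;> rfl
  have a1 := hs2 0 2 (by omega) (by omega) ⟨by omega, Or.inr hac⟩
  have a2 := hs2 2 1 (by omega) (by omega) ⟨by omega, Or.inr hcb⟩
  have b1 := ht2 0 2 (by omega) (by omega) ⟨by omega, Or.inr had⟩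
  have b2 := ht2 2 3 (by omega) (by omega) ⟨by omega, Or.inr hde⟩
  have b3 := ht2 3 1 (by omega) (by omega) ⟨by omega, Or.inr heb⟩
  have c0 := hs1 0 (by omega)
  have c1 := hs1 1 (by omega)
  have c2 := hs1 2 (by omega)
  have d2 := ht1 2 (by omega)
  have d3 := ht1 3 (by omega)
  omega

theorem C5plus_adj_iff (i j : Fin 5) : C5plus.Adj i j ↔ i.val + 1 < j.val ∨ j.val + 1 < i.val := by
  simp only [C5plus, SimpleGraph.compl_adj, SimpleGraph.pathGraph_adj]
  omega

theorem P5sq_adj_iff (i j : Fin 5) : P5sq.Adj i j ↔ i ≠ j ∧ i.val ≤ j.val + 2 ∧ j.val ≤ i.val + 2 := by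
  simp only [P5sq, SimpleGraph.fromRel_adj]
  omega

theorem bullGraph_adj_iff (i j : Fin 5) : bullGraph.Adj i j ↔ i ≠ j ∧
    (((i = 0 ∧ j = 1) ∨ (i = 1 ∧ j = 2) ∨ (i = 0 ∧ j = 2) ∨ (i = 0 ∧ j = 3) ∨
      (i = 1 ∧ j = 4)) ∨ ((j = 0 ∧ i = 1) ∨ (j = 1 ∧ i = 2) ∨ (j = 0 ∧ i = 2) ∨
      (j = 0 ∧ i = 3) ∨ (j = 1 ∧ i = 4))) :=
  Iff.rfl

theorem not_algWins_C5plus (σ : List (Fin 5) → ℕ) : ¬ AlgWins C5plus 2 2 σ := by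
  have hadj := C5plus_adj_iff
  refine not_algWins_of_even_odd_paths (a := 2) (b := 3) (c := 0) (d := 4) (e := 1)
    ?_ ?_ ?_ ?_ ?_ ?_ (by decide) ?_ (by decide) ?_ (by decide) σ <;> rw [hadj] <;> decide

theorem not_algWins_P5sq (σ : List (Fin 5) → ℕ) : ¬ AlgWins P5sq 2 2 σ := by
  have hadj := P5sq_adj_iff
  refine not_algWins_of_even_odd_paths (a := 0) (b := 4) (c := 2) (d := 1) (e := 3)
    ?_ ?_ ?_ ?_ ?_ ?_ (by decide) ?_ (by decide) ?_ (by decide) σ <;> rw [hadj] <;> decide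

theorem not_algWins_bullGraph (σ : List (Fin 5) → ℕ) : ¬ AlgWins bullGraph 2 2 σ := by
  intro h
  have hadj := bullGraph_adj_iff
  let s : ℕ → Fin 5 := fun i => if i = 0 then 3 else if i = 1 then 4 else if i = 2 then 0 else 1
  let t : ℕ → Fin 5 := fun i => if i = 0 then 3 else if i = 1 then 4 else if i = 2 then 2 else 0
  let u : ℕ → Fin 5 := fun i => if i = 0 then 3 else if i = 1 then 4 else if i = 2 then 2 else 1
  have hs : LegalPlay bullGraph 2 s 4 := by
    refine legalPlay_of_list [0, 1, 1, 0] (by decide) ?_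
    intro i hi j hj
    simp only [TokenAdj, hadj]
    interval_cases i <;> interval_cases j <;> decide
  have ht : LegalPlay bullGraph 2 t 4 := by
    refine legalPlay_of_list [0, 0, 0, 1] (by decide) ?_
    intro i hi j hj
    simp only [TokenAdj, hadj]
    interval_cases i <;> interval_cases j <;> decide
  have hu : LegalPlay bullGraph 2 u 4 := by
    refine legalPlay_of_list [0, 0, 0, 1] (by decide) ?_
    intro i hi j hj
    simp only [TokenAdj, hadj]
    interval_cases i <;> interval_cases j <;> decide
  obtain ⟨hs1, hs2⟩ := h _ _ hs
  obtain ⟨ht1, ht2⟩ := h _ _ ht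
  obtain ⟨hu1, hu2⟩ := h _ _ hu
  have e0 : colorOf σ s 0 = colorOf σ t 0 := colorOf_congr σ (by decide)
  have e1 : colorOf σ s 1 = colorOf σ u 1 := colorOf_congr σ (by decide)
  have e2 : colorOf σ t 2 = colorOf σ u 2 := colorOf_congr σ (by decide)
  have a1 := hs2 0 2 (by omega) (by omega) (by simp only [TokenAdj, hadj]; decide)
  have a2 := hs2 2 3 (by omega) (by omega) (by simp only [TokenAdj, hadj]; decide)
  have a3 := hs2 3 1 (by omega) (by omega) (by simp only [TokenAdj, hadj]; decide)
  have b1 := ht2 0 3 (by omega) (by omega) (by simp only [TokenAdj, hadj]; decide)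
  have b2 := ht2 3 2 (by omega) (by omega) (by simp only [TokenAdj, hadj]; decide)
  have c1 := hu2 1 3 (by omega) (by omega) (by simp only [TokenAdj, hadj]; decide)
  have c2 := hu2 3 2 (by omega) (by omega) (by simp only [TokenAdj, hadj]; decide)
  have s0 := hs1 0 (by omega)
  have s1 := hs1 1 (by omega)
  have s2 := hs1 2 (by omega)
  have s3 := hs1 3 (by omega)
  have t2 := ht1 2 (by omega)
  have t3 := ht1 3 (by omega)
  have u3 := hu1 3 (by omega)
  omega

theorem cycleGraph_adj_iff_val {n : ℕ} (hn : 3 ≤ n) (i j : Fin n) :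
    (SimpleGraph.cycleGraph n).Adj i j ↔ i.val + 1 = j.val ∨ j.val + 1 = i.val ∨
      (i.val = 0 ∧ j.val + 1 = n) ∨ (j.val = 0 ∧ i.val + 1 = n) := by
  rw [SimpleGraph.cycleGraph_adj']
  have hi := i.isLt
  have hj := j.isLt
  rcases lt_trichotomy i j with hij | rfl | hij
  · rw [Fin.coe_sub_iff_lt.2 hij, Fin.sub_val_of_le hij.le]
    rw [Fin.lt_def] at hij
    omega
  · rw [Fin.sub_val_of_le le_rfl]
    omega
  · rw [Fin.coe_sub_iff_lt.2 hij, Fin.sub_val_of_le hij.le]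
    rw [Fin.lt_def] at hij
    omega

theorem not_algWins_cycleGraph {n : ℕ} (hn : 5 ≤ n) (hodd : Odd n) (σ : List (Fin n) → ℕ) :
    ¬ AlgWins (SimpleGraph.cycleGraph n) 2 2 σ := by
  intro h
  obtain ⟨m, rfl⟩ := hodd
  let s : ℕ → Fin (2 * m + 1) := fun i =>
    if i = 0 then ⟨0, by omega⟩ else if i = 1 then ⟨2, by omega⟩ else ⟨1, by omega⟩
  let t : ℕ → Fin (2 * m + 1) := fun i =>
    if h : 1 ≤ i ∧ i + 1 < 2 * m + 1 then ⟨i + 1, h.2⟩ else ⟨0, by omega⟩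
  have hadj := cycleGraph_adj_iff_val (n := 2 * m + 1) (by omega)
  have hs : LegalPlay (SimpleGraph.cycleGraph (2 * m + 1)) 2 s 3 := by
    refine legalPlay_of_list [0, 0, 1] (by decide) ?_
    intro i hi j hj
    interval_cases i <;> interval_cases j <;>
      simp [TokenAdj, s, hadj] <;> omega
  have ht0 : (t 0).val = 0 := rfl
  have htv : ∀ i, 1 ≤ i → i < 2 * m → (t i).val = i + 1 := by
    intro i hi hi'
    have : 1 ≤ i ∧ i + 1 < 2 * m + 1 := by omega
    exact congrArg Fin.val (dif_pos this)
  have ht : LegalPlay (SimpleGraph.cycleGraph (2 * m + 1)) 2 t (2 * m) := by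
    refine ⟨fun i => i % 2, fun i _ => Nat.mod_lt _ (by omega), ?_⟩
    rintro i j hi hj ⟨hne, hij⟩
    rw [hadj, Fin.ext_iff] at hij
    dsimp only
    rcases Nat.eq_zero_or_pos i with rfl | hi0 <;> rcases Nat.eq_zero_or_pos j with rfl | hj0
    · omega
    · rw [ht0, htv j hj0 hj] at hij; omega
    · rw [ht0, htv i hi0 hi] at hij; omega
    · rw [htv i hi0 hi, htv j hj0 hj] at hij; omega
  obtain ⟨hs1, hs2⟩ := h _ _ hs
  obtain ⟨ht1, ht2⟩ := h _ _ ht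
  have hts : ∀ j ≤ 1, s j = t j := by
    intro j hj
    interval_cases j
    · rfl
    · exact Fin.ext (htv 1 le_rfl (by omega)).symm
  have e0 : colorOf σ s 0 = colorOf σ t 0 := colorOf_congr σ fun j hj => hts j (by omega)
  have e1 : colorOf σ s 1 = colorOf σ t 1 := colorOf_congr σ fun j hj => hts j (by omega)
  have a1 := hs2 0 2 (by omega) (by omega) ⟨by omega, Or.inr ((hadj _ _).2 (by simp [s]))⟩
  have a2 := hs2 2 1 (by omega) (by omega) ⟨by omega, Or.inr ((hadj _ _).2 (by simp [s]))⟩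
  have step : ∀ i, 1 ≤ i → i + 1 < 2 * m → colorOf σ t i ≠ colorOf σ t (i + 1) := by
    intro i hi hi'
    refine ht2 i (i + 1) (by omega) hi' ⟨by omega, Or.inr ((hadj _ _).2 ?_)⟩
    rw [htv i hi (by omega), htv (i + 1) (by omega) hi']
    omega
  have alt : ∀ k, 2 * k + 1 < 2 * m → colorOf σ t (2 * k + 1) = colorOf σ t 1 := by
    intro k
    induction k with
    | zero => intro; rfl
    | succ k ih =>
      intro hk
      have h1 := step (2 * k + 1) (by omega) (by omega)
      have h2 := step (2 * k + 2) (by omega) (by omega)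
      have h3 := ht1 (2 * k + 1) (by omega)
      have h4 := ht1 (2 * k + 2) (by omega)
      have h5 := ht1 (2 * k + 3) (by omega)
      have h6 := ih (by omega)
      have h7 : colorOf σ t (2 * k + 3) = colorOf σ t (2 * k + 1) := by
        simp only [Nat.add_assoc, Nat.reduceAdd] at *
        omega
      exact h7.trans h6
  have last := alt (m - 1) (by omega)
  have close := ht2 0 (2 * (m - 1) + 1) (by omega) (by omega)
    ⟨by omega, Or.inr ((hadj _ _).2 (by rw [ht0, htv _ (by omega) (by omega)]; omega))⟩
  have c0 := hs1 0 (by omega)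
  have c1 := hs1 1 (by omega)
  have c2 := hs1 2 (by omega)
  omega

theorem HasObstruction.not_algWins {V : Type*} {G : SimpleGraph V} (h : HasObstruction G)
    (σ : List V → ℕ) : ¬ AlgWins G 2 2 σ := by
  intro hσ
  rcases h with ⟨n, hn, hodd, ⟨e⟩⟩ | ⟨⟨e⟩⟩ | ⟨⟨e⟩⟩ | ⟨⟨e⟩⟩
  · exact not_algWins_cycleGraph hn hodd _ (hσ.comap e)
  · exact not_algWins_C5plus _ (hσ.comap e)
  · exact not_algWins_P5sq _ (hσ.comap e)
  · exact not_algWins_bullGraph _ (hσ.comap e)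

/-! ### Forbidden induced subgraphs -/

theorem nonempty_embedding_of_adj_iff {V W : Type*} {H : SimpleGraph W} {G : SimpleGraph V}
    (f : W → V) (h : ∀ i j, G.Adj (f i) (f j) ↔ H.Adj i j)
    (htwin : ∀ i j, (∀ k, H.Adj i k ↔ H.Adj j k) → i = j) : Nonempty (H ↪g G) :=
  ⟨⟨⟨f, fun i j hij => htwin i j fun k => by rw [← h, ← h, hij]⟩, h _ _⟩⟩

/-- The house: a square `a b c d` together with a vertex `r` adjacent to `a` and `b` only. -/
theorem HasObstruction.of_house {V : Type*} {G : SimpleGraph V} {r a b c d : V}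
    (hab : G.Adj a b) (hbc : G.Adj b c) (hcd : G.Adj c d) (hda : G.Adj d a)
    (hra : G.Adj r a) (hrb : G.Adj r b) (hac : ¬ G.Adj a c) (hbd : ¬ G.Adj b d)
    (hrc : ¬ G.Adj r c) (hrd : ¬ G.Adj r d) : HasObstruction G := by
  have hadj := C5plus_adj_iff
  refine Or.inr (Or.inl (nonempty_embedding_of_adj_iff ![a, c, r, d, b] ?_ ?_))
  · intro i j
    rw [hadj]
    fin_cases i <;> fin_cases j <;> simp_all [G.adj_comm]
  · simp only [hadj]
    decide

/-- A path `a b c d` together with a vertex `t` adjacent to all of its vertices. -/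
theorem HasObstruction.of_gem {V : Type*} {G : SimpleGraph V} {a b c d t : V}
    (hab : G.Adj a b) (hbc : G.Adj b c) (hcd : G.Adj c d) (hta : G.Adj t a)
    (htb : G.Adj t b) (htc : G.Adj t c) (htd : G.Adj t d) (hac : ¬ G.Adj a c)
    (had : ¬ G.Adj a d) (hbd : ¬ G.Adj b d) : HasObstruction G := by
  have hadj := P5sq_adj_iff
  refine Or.inr (Or.inr (Or.inl (nonempty_embedding_of_adj_iff ![a, b, t, c, d] ?_ ?_)))
  · intro i j
    rw [hadj]
    fin_cases i <;> fin_cases j <;> simp_all [G.adj_comm]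
  · simp only [hadj]
    decide

/-- A triangle `x y t` with pendant vertices `p` at `x` and `q` at `y`. -/
theorem HasObstruction.of_bull {V : Type*} {G : SimpleGraph V} {x y t p q : V}
    (hxy : G.Adj x y) (hyt : G.Adj y t) (hxt : G.Adj x t) (hpx : G.Adj p x)
    (hqy : G.Adj q y) (hpy : ¬ G.Adj p y) (hpt : ¬ G.Adj p t) (hqx : ¬ G.Adj q x)
    (hqt : ¬ G.Adj q t) (hpq : ¬ G.Adj p q) : HasObstruction G := by
  have hadj := bullGraph_adj_iff
  refine Or.inr (Or.inr (Or.inr (nonempty_embedding_of_adj_iff ![x, y, t, p, q] ?_ ?_)))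
  · intro i j
    rw [hadj]
    fin_cases i <;> fin_cases j <;> simp_all [G.adj_comm]
  · simp only [hadj]
    set_option synthInstance.maxSize 1000 in decide

theorem HasObstruction.of_cycle {V : Type*} {G : SimpleGraph V} {n : ℕ} (hn : 5 ≤ n)
    (hodd : Odd n) (g : ℕ → V)
    (hadj : ∀ i j, i < j → j < n → (G.Adj (g i) (g j) ↔ i + 1 = j ∨ (i = 0 ∧ j + 1 = n)))
    (hne : ∀ i j, i < j → j < n → g i ≠ g j) : HasObstruction G := by
  refine Or.inl ⟨n, hn, hodd, ⟨⟨⟨fun i => g i, ?_⟩, ?_⟩⟩⟩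
  · intro i j hij
    rcases lt_trichotomy i j with h | h | h
    · exact absurd hij (hne i j h j.isLt)
    · exact h
    · exact absurd hij.symm (hne j i h i.isLt)
  · intro i j
    rw [cycleGraph_adj_iff_val (by omega)]
    change G.Adj (g i) (g j) ↔ _
    have hi := i.isLt
    have hj := j.isLt
    rcases lt_trichotomy i j with h | h | h
    · rw [hadj i j h hj]
      rw [Fin.lt_def] at h
      omega
    · subst h
      simp only [SimpleGraph.irrefl, false_iff]
      omega
    · rw [G.adj_comm, hadj j i h hi]
      rw [Fin.lt_def] at h
      omega

theorem HasObstruction.map {V W : Type*} {H : SimpleGraph W} {G : SimpleGraph V}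
    (h : HasObstruction H) (e : H ↪g G) : HasObstruction G := by
  rcases h with ⟨n, hn, hodd, ⟨f⟩⟩ | ⟨⟨f⟩⟩ | ⟨⟨f⟩⟩ | ⟨⟨f⟩⟩
  · exact Or.inl ⟨n, hn, hodd, ⟨e.comp f⟩⟩
  · exact Or.inr (Or.inl ⟨e.comp f⟩)
  · exact Or.inr (Or.inr (Or.inl ⟨e.comp f⟩))
  · exact Or.inr (Or.inr (Or.inr ⟨e.comp f⟩))

/-! ### Induced shortest paths -/

/-- Vertices joined by a walk are joined by an induced path. -/
theorem SimpleGraph.Reachable.exists_induced_path {V : Type*} {G : SimpleGraph V} {a b : V}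
    (h : G.Reachable a b) : ∃ (n : ℕ) (f : ℕ → V), f 0 = a ∧ f n = b ∧
      (∀ i j, i < j → j ≤ n → (G.Adj (f i) (f j) ↔ i + 1 = j)) ∧
      ∀ i j, i < j → j ≤ n → f i ≠ f j := by
  obtain ⟨w, hw⟩ := h.exists_walk_length_eq_dist
  have hdist : ∀ i ≤ w.length, G.dist a (w.getVert i) = i := by
    intro i hi
    have h1 : G.dist a (w.getVert i) ≤ i :=
      (SimpleGraph.dist_le (w.take i)).trans (by simp)
    obtain ⟨w', hw'⟩ := (w.take i).reachable.exists_walk_length_eq_dist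
    have h2 := SimpleGraph.dist_le (w'.append (w.drop i))
    rw [SimpleGraph.Walk.length_append, SimpleGraph.Walk.drop_length, hw', ← hw] at h2
    omega
  refine ⟨w.length, w.getVert, w.getVert_zero, w.getVert_length, ?_, ?_⟩
  · intro i j hij hj
    constructor
    · intro hadj
      obtain ⟨w', hw'⟩ := (w.take i).reachable.exists_walk_length_eq_dist
      have h2 := SimpleGraph.dist_le (w'.concat hadj)
      rw [SimpleGraph.Walk.length_concat, hw', hdist i (by omega), hdist j hj] at h2
      omega
    · rintro rfl
      exact w.adj_getVert_succ (by omega)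
  · intro i j hij hj heq
    have := hdist i (by omega)
    rw [heq, hdist j hj] at this
    omega

/-! ### Choosing a root module -/

/-- `IsSplitSet G R u z`: no bipartition of `R` avoids all edges, `u` is complete to `R`, and
`z` is a neighbor of `u` outside `R` with no neighbors in `R`. -/
structure IsSplitSet {V : Type*} (G : SimpleGraph V) (R : Set V) (u z : V) : Prop where
  nonempty : R.Nonempty
  cut : ∀ P : V → Prop, (∃ a ∈ R, P a) → (∃ b ∈ R, ¬ P b) →
    ∃ a ∈ R, ∃ b ∈ R, P a ∧ ¬ P b ∧ G.Adj a b
  complete : ∀ r ∈ R, G.Adj u r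
  adj : G.Adj u z
  notMem : z ∉ R
  anticomplete : ∀ r ∈ R, ¬ G.Adj z r

theorem IsSplitSet.insert {V : Type*} {G : SimpleGraph V} {R : Set V} {u z u' z' x a : V}
    (h : IsSplitSet G R u z) (ha : a ∈ R) (hxa : G.Adj x a) (hcomp : ∀ r ∈ R, G.Adj u' r)
    (hadj : G.Adj u' z') (hz : z' ∉ R) (hanti : ∀ r ∈ R, ¬ G.Adj z' r) (hux : G.Adj u' x)
    (hzx : ¬ G.Adj z' x) (hzx' : z' ≠ x) : IsSplitSet G (insert x R) u' z' := by
  refine ⟨⟨x, Set.mem_insert _ _⟩, ?_, ?_, hadj, ?_, ?_⟩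
  · rintro P ⟨p, hp, hPp⟩ ⟨q, hq, hPq⟩
    by_cases hall : ∀ r ∈ R, P r
    · have hPx : ¬ P x := by
        rcases hq with rfl | hq
        · exact hPq
        · exact absurd (hall q hq) hPq
      exact ⟨a, Or.inr ha, x, Or.inl rfl, hall a ha, hPx, hxa.symm⟩
    · push Not at hall
      by_cases hnone : ∃ r ∈ R, P r
      · obtain ⟨a', ha', b', hb', hab⟩ := h.cut P hnone hall
        exact ⟨a', Or.inr ha', b', Or.inr hb', hab⟩
      · push Not at hnone
        have hPx : P x := by
          rcases hp with rfl | hp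
          · exact hPp
          · exact absurd hPp (hnone p hp)
        exact ⟨x, Or.inl rfl, a, Or.inr ha, hPx, hnone a ha, hxa⟩
  · rintro r (rfl | hr)
    exacts [hux, hcomp r hr]
  · rintro (rfl | hr)
    exacts [hzx' rfl, hz hr]
  · rintro r (rfl | hr)
    exacts [hzx, hanti r hr]

/-- A root set from which the parity of the distance is a good coloring. -/
structure IsRootSet {V : Type*} (G : SimpleGraph V) (R : Set V) : Prop where
  nonempty : R.Nonempty
  module : ∀ x ∉ R, ∀ a ∈ R, ∀ b ∈ R, G.Adj x a → G.Adj x b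
  neighbors : ∀ u ∉ R, ∀ v ∉ R, ∀ z ∉ R, ∀ r ∈ R, G.Adj r u → G.Adj r v → G.Adj u v →
    ¬ G.Adj r z → G.Adj z u → G.Adj z v
  no_path : ∀ w ∈ R, ∀ x ∈ R, ∀ y ∈ R, ∀ z ∈ R, G.Adj w x → G.Adj x y → G.Adj y z →
    G.Adj w y ∨ G.Adj x z ∨ G.Adj w z

theorem exists_isRootSet {V : Type*} [Finite V] [Nonempty V] {G : SimpleGraph V}
    (hG : ¬ HasObstruction G) : ∃ R, IsRootSet G R := by
  by_cases hex : ∃ R u z, IsSplitSet G R u z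
  · obtain ⟨R, hR⟩ := (Set.toFinite {R : Set V | ∃ u z, IsSplitSet G R u z}).exists_maximal hex
    obtain ⟨⟨u, z, h⟩, hmax⟩ := hR
    have hmax' : ∀ x ∉ R, ∀ u z, ¬ IsSplitSet G (insert x R) u z := by
      intro x hx u z hS
      exact hx (hmax ⟨u, z, hS⟩ (Set.subset_insert x R) (Set.mem_insert x R))
    have hmod : ∀ x ∉ R, ∀ a ∈ R, ∀ b ∈ R, G.Adj x a → G.Adj x b := by
      intro x hx a₀ ha₀ b₀ hb₀ hxa₀
      by_contra hxb₀
      obtain ⟨a, ha, b, hb, hxa, hxb, hab⟩ :=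
        h.cut (fun v => G.Adj x v) ⟨a₀, ha₀, hxa₀⟩ ⟨b₀, hb₀, hxb₀⟩
      have hua := h.complete a ha
      have hub := h.complete b hb
      have huz := h.adj
      have hza := h.anticomplete a ha
      have hzb := h.anticomplete b hb
      have hzx' : z ≠ x := by
        rintro rfl
        exact hza hxa
      have hxu' : x ≠ u := by
        rintro rfl
        exact hxb hub
      have hux : G.Adj u x := by
        by_contra hux
        by_cases hxz : G.Adj x z
        · exact hG (HasObstruction.of_house (r := b) (a := a) (b := u) (c := z) (d := x)
            hua.symm huz hxz.symm hxa hab.symm hub.symm (fun h => hza h.symm) hux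
            (fun h => hzb h.symm) (fun h => hxb h.symm))
        · exact hG (HasObstruction.of_bull (x := u) (y := a) (t := b) (p := z) (q := x)
            hua hab hub huz.symm hxa hza hzb (fun h => hux h.symm) hxb (fun h => hxz h.symm))
      have hzx : ¬ G.Adj z x := by
        intro hzx
        exact hG (HasObstruction.of_gem (a := b) (b := a) (c := x) (d := z) (t := u)
          hab.symm hxa.symm hzx.symm hub hua hux huz (fun h => hxb h.symm)
          (fun h => hzb h.symm) (fun h => hza h.symm))
      exact hmax' x hx u z (h.insert ha hxa h.complete h.adj h.notMem h.anticomplete hux hzx hzx')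
    refine ⟨R, h.nonempty, hmod, ?_, ?_⟩
    · intro u' hu' v hv z' hz' r hr hru hrv huv hrz hzu
      by_contra hzv
      refine hmax' v hv u' z' (h.insert hr hrv.symm ?_ hzu.symm hz' ?_ huv hzv ?_)
      · intro s hs
        exact hmod u' hu' r hr s hs hru.symm
      · intro s hs hzs
        exact hrz (hmod z' hz' s hs r hr hzs).symm
      · rintro rfl
        exact hrz hrv
    · intro w hw x hx y hy z' hz' hwx hxy hyz
      by_contra! hcon
      exact hG (HasObstruction.of_gem hwx hxy hyz (h.complete w hw) (h.complete x hx)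
        (h.complete y hy) (h.complete z' hz') hcon.1 hcon.2.2 hcon.2.1)
  · obtain ⟨r⟩ := ‹Nonempty V›
    refine ⟨{r}, Set.singleton_nonempty r, ?_, ?_, ?_⟩
    · rintro x - a rfl b rfl h
      exact h
    · rintro u - v - z hz r' rfl hru hrv huv hrz hzu
      refine absurd ⟨{r'}, u, z, Set.singleton_nonempty r', ?_, ?_, hzu.symm, hz, ?_⟩ hex
      · rintro P ⟨a, rfl, ha⟩ ⟨b, rfl, hb⟩
        exact absurd ha hb
      · rintro s rfl
        exact hru.symm
      · rintro s rfl h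
        exact hrz h.symm
    · rintro w rfl x rfl y - z - h
      exact absurd h (G.irrefl)

/-! ### Levels -/

/-- `ℓ` is a distance function from the root set `R`. -/
structure IsLevelFunction {V : Type*} (G : SimpleGraph V) (R : Set V) (ℓ : V → ℕ) : Prop where
  zero_iff : ∀ v, ℓ v = 0 ↔ v ∈ R
  le_succ : ∀ u v, G.Adj u v → ℓ v ≤ ℓ u + 1
  exists_pred : ∀ v k, ℓ v = k + 1 → ∃ p, G.Adj p v ∧ ℓ p = k

theorem exists_isLevelFunction {V : Type*} {G : SimpleGraph V} (hG : G.Connected) {R : Set V}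
    (hR : R.Nonempty) : ∃ ℓ, IsLevelFunction G R ℓ := by
  obtain ⟨r₀, hr₀⟩ := hR
  let ℓ : V → ℕ := fun v => sInf {n | ∃ r ∈ R, G.dist r v = n}
  have hmem : ∀ v, ∃ r ∈ R, G.dist r v = ℓ v := fun v =>
    Nat.sInf_mem (s := {n | ∃ r ∈ R, G.dist r v = n}) ⟨_, r₀, hr₀, rfl⟩
  have hle : ∀ v, ∀ r ∈ R, ℓ v ≤ G.dist r v := fun v r hr => Nat.sInf_le ⟨r, hr, rfl⟩
  have hsucc : ∀ u v, G.Adj u v → ℓ v ≤ ℓ u + 1 := by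
    intro u v huv
    obtain ⟨r, hr, hru⟩ := hmem u
    have h1 := hle v r hr
    have h2 := hG.dist_triangle (u := r) (v := u) (w := v)
    rw [SimpleGraph.dist_eq_one_iff_adj.2 huv, hru] at h2
    exact h1.trans h2
  refine ⟨ℓ, ?_, hsucc, ?_⟩
  · intro v
    constructor
    · intro hv
      obtain ⟨r, hr, hrv⟩ := hmem v
      rw [hv, hG.dist_eq_zero_iff] at hrv
      exact hrv ▸ hr
    · intro hv
      have := hle v v hv
      rw [SimpleGraph.dist_self] at this
      omega
  · intro v k hv
    obtain ⟨r, hr, hrv⟩ := hmem v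
    obtain ⟨w, hw⟩ := hG.exists_walk_length_eq_dist r v
    have hlen : w.length = k + 1 := by omega
    have hadj := w.adj_getVert_succ (i := k) (by omega)
    rw [← hlen, w.getVert_length] at hadj
    refine ⟨_, hadj, ?_⟩
    have h1 := hle (w.getVert k) r hr
    have h2 := SimpleGraph.dist_le (w.take k)
    have h3 : (w.take k).length = k := by simp [hlen]
    have h4 := hsucc _ _ hadj
    omega

/-- Adjacent vertices on level `k + 1` have the same neighbors on level `k`. -/
def TwinsBelow {V : Type*} (G : SimpleGraph V) (ℓ : V → ℕ) (k : ℕ) : Prop :=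
  ∀ u v p, ℓ u = k + 1 → ℓ v = k + 1 → ℓ p = k → G.Adj u v → G.Adj p u → G.Adj p v

section Levels

variable {V : Type*} {G : SimpleGraph V} {R : Set V} {ℓ : V → ℕ}

/-- Adjacent vertices on a level have the same neighbors on the level above. -/
theorem IsLevelFunction.adj_above (hG : ¬ HasObstruction G) (hR : IsRootSet G R)
    (hℓ : IsLevelFunction G R ℓ) {k : ℕ} (hk : ∀ j < k, TwinsBelow G ℓ j) {u v z : V}
    (hu : ℓ u = k) (hv : ℓ v = k) (hz : ℓ z = k + 1) (huv : G.Adj u v) (hzu : G.Adj z u) :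
    G.Adj z v := by
  have hmem : ∀ x, ℓ x ≠ 0 → x ∉ R := fun x hx hxR => hx ((hℓ.zero_iff x).2 hxR)
  rcases k with _ | k
  · exact hR.module z (hmem z (by omega)) u ((hℓ.zero_iff u).1 hu) v ((hℓ.zero_iff v).1 hv) hzu
  obtain ⟨p, hpu, hp⟩ := hℓ.exists_pred u k hu
  have hpv := hk k (by omega) u v p hu hv hp huv hpu
  have hpz : ¬ G.Adj p z := fun h => by
    have := hℓ.le_succ _ _ h
    omega
  rcases k with _ | k
  · exact hR.neighbors u (hmem u (by omega)) v (hmem v (by omega)) z (hmem z (by omega)) p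
      ((hℓ.zero_iff p).1 hp) hpu hpv huv hpz hzu
  · obtain ⟨p', hp'p, hp'⟩ := hℓ.exists_pred p k hp
    by_contra hzv
    have hp'u : ¬ G.Adj p' u := fun h => by
      have := hℓ.le_succ _ _ h
      omega
    have hp'v : ¬ G.Adj p' v := fun h => by
      have := hℓ.le_succ _ _ h
      omega
    have hp'z : ¬ G.Adj p' z := fun h => by
      have := hℓ.le_succ _ _ h
      omega
    exact hG (HasObstruction.of_bull (x := u) (y := p) (t := v) (p := z) (q := p')
      hpu.symm hpv huv hzu hp'p (fun h => hpz h.symm) hzv hp'u hp'v fun h => hp'z h.symm)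

/-- The ends of an induced path on three vertices have levels of the same parity. -/
theorem IsLevelFunction.mod_two_eq (hG : ¬ HasObstruction G) (hR : IsRootSet G R)
    (hℓ : IsLevelFunction G R ℓ) {k : ℕ} (hk : ∀ j < k, TwinsBelow G ℓ j) {x y z : V}
    (hx : ℓ x ≤ k) (hy : ℓ y ≤ k) (hz : ℓ z ≤ k) (hxy : G.Adj x y) (hyz : G.Adj y z)
    (hxz : ¬ G.Adj x z) : ℓ x % 2 = ℓ z % 2 := by
  have key : ∀ a b, ℓ a ≤ k → ℓ b ≤ k → G.Adj a y → G.Adj y b → ¬ G.Adj a b → ℓ a = ℓ y →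
      ℓ b = ℓ y + 1 ∨ ℓ y = ℓ b + 1 → False := by
    intro a b ha hb hay hyb hab hlev h
    rcases h with h | h
    · exact hab (hℓ.adj_above hG hR (fun j hj => hk j (by omega)) rfl hlev h hay.symm
        hyb.symm).symm
    · exact hab (hk (ℓ b) (by omega) y a b h (by omega) rfl hay.symm hyb.symm).symm
  have h1 := hℓ.le_succ _ _ hxy
  have h2 := hℓ.le_succ _ _ hxy.symm
  have h3 := hℓ.le_succ _ _ hyz
  have h4 := hℓ.le_succ _ _ hyz.symm
  by_contra hne
  by_cases hlev : ℓ x = ℓ y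
  · exact key x z hx hz hxy hyz hxz hlev (by omega)
  · exact key z x hz hx hyz.symm hxy.symm (fun h => hxz h.symm) (by omega) (by omega)

/-- Two vertices on the same positive level are joined by a path all of whose inner vertices
lie on lower levels, and which is induced. -/
theorem IsLevelFunction.exists_induced_path (hR : IsRootSet G R)
    (hℓ : IsLevelFunction G R ℓ) {k : ℕ} {p q : V} (hp : ℓ p = k + 1) (hq : ℓ q = k + 1) :
    ∃ (n : ℕ) (f : ℕ → V), f 0 = p ∧ f n = q ∧
      (∀ i j, i < j → j ≤ n → (G.Adj (f i) (f j) ↔ i + 1 = j)) ∧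
      (∀ i j, i < j → j ≤ n → f i ≠ f j) ∧ ∀ i, 0 < i → i < n → ℓ (f i) ≤ k := by
  let S : Set V := {x | ℓ x ≤ k ∨ x = p ∨ x = q}
  obtain ⟨r, hr⟩ := hR.nonempty
  have hr0 : ℓ r = 0 := (hℓ.zero_iff r).2 hr
  have hrS : r ∈ S := Or.inl (by omega)
  have hreach : ∀ j, ∀ x, ∀ hx : x ∈ S, ℓ x = j + 1 → j ≤ k →
      (G.induce S).Reachable ⟨x, hx⟩ ⟨r, hrS⟩ := by
    intro j
    induction j with
    | zero =>
      intro x hx hlx _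
      obtain ⟨r', hr'x, hr'⟩ := hℓ.exists_pred x 0 hlx
      have hxr : G.Adj x r := hR.module x
        (fun h => by
          have := (hℓ.zero_iff x).2 h
          omega)
        r' ((hℓ.zero_iff r').1 hr') r hr hr'x.symm
      exact SimpleGraph.Adj.reachable (by simpa using hxr)
    | succ j ih =>
      intro x hx hlx hjk
      obtain ⟨y, hyx, hy⟩ := hℓ.exists_pred x (j + 1) hlx
      have hyS : y ∈ S := Or.inl (by omega)
      have hadj : (G.induce S).Adj ⟨x, hx⟩ ⟨y, hyS⟩ := by simpa using hyx.symm
      exact hadj.reachable.trans (ih y hyS hy (by omega))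
  have hpS : p ∈ S := Or.inr (Or.inl rfl)
  have hqS : q ∈ S := Or.inr (Or.inr rfl)
  obtain ⟨n, f, hf0, hfn, hadj, hne⟩ :=
    ((hreach k p hpS hp le_rfl).trans (hreach k q hqS hq le_rfl).symm).exists_induced_path
  refine ⟨n, fun i => f i, by simp [hf0], by simp [hfn], ?_, ?_, ?_⟩
  · intro i j hij hj
    rw [← hadj i j hij hj, SimpleGraph.comap_adj]
    rfl
  · intro i j hij hj h
    exact hne i j hij hj (Subtype.ext h)
  · intro i hi hin
    rcases (f i).2 with h | h | h
    · exact h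
    · refine absurd ?_ (hne 0 i hi hin.le)
      rw [hf0]
      exact Subtype.ext h.symm
    · refine absurd ?_ (hne i n hin le_rfl)
      rw [hfn]
      exact Subtype.ext h

theorem IsLevelFunction.twinsBelow (hG : ¬ HasObstruction G) (hR : IsRootSet G R)
    (hℓ : IsLevelFunction G R ℓ) (k : ℕ) : TwinsBelow G ℓ k := by
  induction k using Nat.strong_induction_on with
  | _ k ih =>
  have hfar : ∀ {a b : V}, ℓ a + 1 < ℓ b → ¬ G.Adj a b := fun h h' => by
    have := hℓ.le_succ _ _ h'
    omega
  intro u v p hu hv hp huv hpu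
  obtain ⟨q, hqv, hq⟩ := hℓ.exists_pred v k hv
  rcases k with _ | k
  · refine (hR.module v (fun h => ?_) q ((hℓ.zero_iff q).1 hq) p ((hℓ.zero_iff p).1 hp)
      hqv.symm).symm
    have := (hℓ.zero_iff v).2 h
    omega
  by_contra hpv
  have hpq' : p ≠ q := by
    rintro rfl
    exact hpv hqv
  by_cases hpq : G.Adj p q
  · obtain ⟨p', hp'p, hp'⟩ := hℓ.exists_pred p k hp
    have hp'q := ih k (by omega) p q p' hp hq hp' hpq hp'p
    have hp'u : ¬ G.Adj p' u := hfar (by omega)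
    have hp'v : ¬ G.Adj p' v := hfar (by omega)
    by_cases hqu : G.Adj q u
    · exact hG (HasObstruction.of_gem (a := p') (b := p) (c := u) (d := v) (t := q)
        hp'p hpu huv hp'q.symm hpq.symm hqu hqv hp'u hp'v hpv)
    · exact hG (HasObstruction.of_house (r := p') (a := p) (b := q) (c := v) (d := u)
        hpq hqv huv.symm hpu.symm hp'p hp'q hpv hqu hp'v hp'u)
  · by_cases hqu : G.Adj q u
    · obtain ⟨q', hq'q, hq'⟩ := hℓ.exists_pred q k hq
      have hq'u : ¬ G.Adj q' u := hfar (by omega)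
      have hq'v : ¬ G.Adj q' v := hfar (by omega)
      by_cases hq'p : G.Adj q' p
      · exact hG (HasObstruction.of_house (r := v) (a := u) (b := q) (c := q') (d := p)
          hqu.symm hq'q.symm hq'p hpu huv.symm hqv.symm (fun h => hq'u h.symm)
          (fun h => hpq h.symm) (fun h => hq'v h.symm) (fun h => hpv h.symm))
      · exact hG (HasObstruction.of_bull (x := u) (y := q) (t := v) (p := p) (q := q')
          hqu.symm hqv huv hpu hq'q hpq hpv hq'u hq'v fun h => hq'p h.symm)
    · obtain ⟨n, f, hf0, hfn, hadj, hne, hlow⟩ := hℓ.exists_induced_path hR hp hq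
      have hn0 : n ≠ 0 := by
        rintro rfl
        exact hpq' (hf0.symm.trans hfn)
      have hn1 : n ≠ 1 := by
        rintro rfl
        exact hpq (by rw [← hf0, ← hfn]; exact (hadj 0 1 (by omega) le_rfl).2 rfl)
      have hlev : ∀ i ≤ n, ℓ (f i) ≤ k + 1 := by
        intro i hi
        rcases Nat.eq_zero_or_pos i with rfl | hi0
        · rw [hf0]; omega
        · rcases hi.lt_or_eq with hin | rfl
          · have := hlow i hi0 hin
            omega
          · rw [hfn]; omega
      have hstep : ∀ i, i + 2 ≤ n → ℓ (f i) % 2 = ℓ (f (i + 2)) % 2 := by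
        intro i hi
        refine hℓ.mod_two_eq hG hR ih (y := f (i + 1)) (hlev _ (by omega))
          (hlev _ (by omega)) (hlev _ hi) ((hadj _ _ (by omega) (by omega)).2 rfl)
          ((hadj _ _ (by omega) (by omega)).2 rfl) fun h => ?_
        have := (hadj _ _ (by omega) hi).1 h
        omega
      have heven : ∀ j, 2 * j ≤ n → ℓ (f (2 * j)) % 2 = (k + 1) % 2 := by
        intro j
        induction j with
        | zero => intro _; rw [Nat.mul_zero, hf0, hp]
        | succ j ihj =>
          intro hj
          rw [← ihj (by omega)]
          exact (hstep (2 * j) hj).symm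
      have hn : Even n := by
        by_contra hodd
        obtain ⟨m, rfl⟩ := Nat.not_even_iff_odd.1 hodd
        have h1 := heven m (by omega)
        have h2 := hlow (2 * m) (by omega) (by omega)
        have h3 := hℓ.le_succ (f (2 * m)) (f (2 * m + 1))
          ((hadj _ _ (by omega) le_rfl).2 rfl)
        rw [hfn, hq] at h3
        omega
      have hfv : ∀ i ≤ n, G.Adj (f i) v ↔ i = n := by
        intro i hi
        constructor
        · intro h
          by_contra hin
          rcases Nat.eq_zero_or_pos i with rfl | hi0
          · exact hpv (hf0 ▸ h)
          · have := hlow i hi0 (by omega)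
            exact hfar (by omega) h
        · rintro rfl
          rwa [hfn]
      have hfu : ∀ i ≤ n, G.Adj (f i) u ↔ i = 0 := by
        intro i hi
        constructor
        · intro h
          by_contra hi0
          rcases hi.lt_or_eq with hin | rfl
          · have := hlow i (by omega) hin
            exact hfar (by omega) h
          · exact hqu (hfn ▸ h)
        · rintro rfl
          rwa [hf0]
      let g : ℕ → V := fun i => if i ≤ n then f i else if i = n + 1 then v else u
      have hgf : ∀ i ≤ n, g i = f i := fun i hi => if_pos hi
      have hgv : g (n + 1) = v := by simp [g]
      have hgu : g (n + 2) = u := by simp [g]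
      refine hG (HasObstruction.of_cycle (n := n + 3) (by omega) ?_ g ?_ ?_)
      · rw [Nat.odd_iff]
        rw [Nat.even_iff] at hn
        omega
      · intro i j hij hj
        rcases (by omega : j ≤ n ∨ j = n + 1 ∨ j = n + 2) with hjn | rfl | rfl
        · rw [hgf i (by omega), hgf j hjn, hadj i j hij hjn]
          omega
        · rw [hgf i (by omega), hgv, hfv i (by omega)]
          omega
        · rw [hgu]
          rcases (by omega : i ≤ n ∨ i = n + 1) with hin | rfl
          · rw [hgf i hin, hfu i hin]
            omega
          · rw [hgv]
            simp [huv.symm]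
      · intro i j hij hj
        rcases (by omega : j ≤ n ∨ j = n + 1 ∨ j = n + 2) with hjn | rfl | rfl
        · rw [hgf i (by omega), hgf j hjn]
          exact hne i j hij hjn
        · rw [hgf i (by omega), hgv]
          intro h
          have := hlev i (by omega)
          rw [h] at this
          omega
        · rw [hgu]
          rcases (by omega : i ≤ n ∨ i = n + 1) with hin | rfl
          · rw [hgf i hin]
            intro h
            have := hlev i hin
            rw [h] at this
            omega
          · rw [hgv]
            exact huv.ne'

end Levels

/-! ### Guiding colorings -/

/-- A (not necessarily proper) two-coloring of the vertices which gives the same color to the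
ends of any induced path on three vertices, and different colors to the two inner vertices of
any induced path on four vertices. -/
structure IsGuide {V : Type*} (G : SimpleGraph V) (c : V → Bool) : Prop where
  ends_eq : ∀ x y z, G.Adj x y → G.Adj y z → x ≠ z → ¬ G.Adj x z → c x = c z
  inner_ne : ∀ w x y z, G.Adj w x → G.Adj x y → G.Adj y z → w ≠ y → x ≠ z → ¬ G.Adj w y →
    ¬ G.Adj x z → ¬ G.Adj w z → c x ≠ c y

theorem exists_isGuide_of_connected {V : Type*} [Finite V] {G : SimpleGraph V}
    (hconn : G.Connected) (hG : ¬ HasObstruction G) : ∃ c, IsGuide G c := by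
  have := hconn.nonempty
  obtain ⟨R, hR⟩ := exists_isRootSet hG
  obtain ⟨ℓ, hℓ⟩ := exists_isLevelFunction hconn hR.nonempty
  have htwin := hℓ.twinsBelow hG hR
  have hpar : ∀ x y z, G.Adj x y → G.Adj y z → ¬ G.Adj x z → ℓ x % 2 = ℓ z % 2 := by
    intro x y z hxy hyz hxz
    exact hℓ.mod_two_eq hG hR (k := ℓ x + ℓ y + ℓ z) (fun j _ => htwin j) (by omega)
      (by omega) (by omega) hxy hyz hxz
  refine ⟨fun v => decide (ℓ v % 2 = 0), ?_, ?_⟩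
  · intro x y z hxy hyz _ hxz
    simp only [hpar x y z hxy hyz hxz]
  · intro w x y z hwx hxy hyz _ _ hwy hxz hwz hcol
    have hxy2 : ℓ x % 2 = ℓ y % 2 := by
      have := decide_eq_decide.1 hcol
      omega
    have h1 := hpar w x y hwx hxy hwy
    have h2 := hpar x y z hxy hyz hxz
    have h3 := hℓ.le_succ _ _ hwx
    have h4 := hℓ.le_succ _ _ hwx.symm
    have h5 := hℓ.le_succ _ _ hxy
    have h6 := hℓ.le_succ _ _ hxy.symm
    have h7 := hℓ.le_succ _ _ hyz
    have h8 := hℓ.le_succ _ _ hyz.symm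
    obtain ⟨k, hk⟩ : ∃ k, k = ℓ w := ⟨_, rfl⟩
    rcases k with _ | k
    · rcases hR.no_path w ((hℓ.zero_iff w).1 (by omega)) x ((hℓ.zero_iff x).1 (by omega)) y
        ((hℓ.zero_iff y).1 (by omega)) z ((hℓ.zero_iff z).1 (by omega)) hwx hxy hyz with h | h | h
      exacts [hwy h, hxz h, hwz h]
    · obtain ⟨t, htw, ht⟩ := hℓ.exists_pred w k hk.symm
      have htx := htwin k w x t (by omega) (by omega) ht hwx htw
      have hty := htwin k x y t (by omega) (by omega) ht hxy htx
      have htz := htwin k y z t (by omega) (by omega) ht hyz hty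
      exact hG (HasObstruction.of_gem hwx hxy hyz htw htx hty htz hwy hwz hxz)

theorem exists_isGuide {V : Type*} [Finite V] {G : SimpleGraph V} (hG : ¬ HasObstruction G) :
    ∃ c, IsGuide G c := by
  have hcomp : ∀ C : G.ConnectedComponent, ∃ c, IsGuide C.toSimpleGraph c := fun C =>
    exists_isGuide_of_connected C.connected_toSimpleGraph
      fun h => hG (h.map (SimpleGraph.Embedding.induce C.supp))
  choose c hc using hcomp
  have heq : ∀ (C : G.ConnectedComponent) (v : V) (hv : G.connectedComponentMk v = C),
      c (G.connectedComponentMk v) ⟨v, rfl⟩ = c C ⟨v, hv⟩ := by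
    rintro C v rfl
    rfl
  have hadj : ∀ {x y : V}, G.Adj x y → G.connectedComponentMk y = G.connectedComponentMk x :=
    fun h => (SimpleGraph.ConnectedComponent.connectedComponentMk_eq_of_adj h).symm
  refine ⟨fun v => c (G.connectedComponentMk v) ⟨v, rfl⟩, ?_, ?_⟩
  · intro x y z hxy hyz hne hxz
    have hy := hadj hxy
    have hz := (hadj hyz).trans hy
    rw [heq _ z hz]
    exact (hc (G.connectedComponentMk x)).ends_eq ⟨x, rfl⟩ ⟨y, hy⟩ ⟨z, hz⟩ hxy hyz
      (fun h => hne (congrArg Subtype.val h)) hxz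
  · intro w x y z hwx hxy hyz hne hne' hwy hxz hwz
    have hx := hadj hwx
    have hy := (hadj hxy).trans hx
    have hz := (hadj hyz).trans hy
    rw [heq _ x hx, heq _ y hy]
    exact (hc (G.connectedComponentMk w)).inner_ne ⟨w, rfl⟩ ⟨x, hx⟩ ⟨y, hy⟩ ⟨z, hz⟩ hwx hxy
      hyz (fun h => hne (congrArg Subtype.val h)) (fun h => hne' (congrArg Subtype.val h))
      hwy hxz hwz

/-! ### Algorithm's strategy -/

theorem TokenAdj.symm {V : Type*} {G : SimpleGraph V} {s : ℕ → V} {i j : ℕ}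
    (h : TokenAdj G s i j) : TokenAdj G s j i :=
  ⟨h.1.symm, h.2.imp Eq.symm SimpleGraph.Adj.symm⟩

theorem LegalPlay.exists_bool {V : Type*} {G : SimpleGraph V} {s : ℕ → V} {n : ℕ}
    (h : LegalPlay G 2 s n) :
    ∃ ψ : ℕ → Bool, ∀ i < n, ∀ j < n, TokenAdj G s i j → ψ i ≠ ψ j := by
  obtain ⟨φ, hφ, hφ'⟩ := h
  refine ⟨fun i => decide (φ i = 0), fun i hi j hj hij heq => ?_⟩
  have h1 := hφ i hi
  have h2 := hφ j hj
  have h3 := hφ' i j hi hj hij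
  have h4 := decide_eq_decide.1 heq
  omega

/-- Two proper two-colorings agree at one end of a path if and only if they agree at the
other end. -/
theorem Relation.ReflTransGen.bool_eq_iff {α : Type*} {r : α → α → Prop} {a b : α → Bool}
    {x y : α} (h : Relation.ReflTransGen r x y)
    (hr : ∀ i j, Relation.ReflTransGen r x i → r i j → a i ≠ a j ∧ b i ≠ b j) :
    a x = b x ↔ a y = b y := by
  induction h with
  | refl => rfl
  | tail hxy hyz ih =>
    obtain ⟨h1, h2⟩ := hr _ _ hxy hyz
    rw [ih]
    revert h1 h2
    cases a _ <;> cases a _ <;> cases b _ <;> cases b _ <;> simp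

section Tokens

variable {V : Type*} {G : SimpleGraph V} {s : ℕ → V} {c : V → Bool} {n : ℕ} {ψ : ℕ → Bool}

theorem not_tokenAdj_of_common_neighbor
    (hψ : ∀ i < n, ∀ j < n, TokenAdj G s i j → ψ i ≠ ψ j) {i j k : ℕ} (hi : i < n) (hj : j < n)
    (hk : k < n) (hij : TokenAdj G s i j) (hik : TokenAdj G s i k) : ¬ TokenAdj G s j k := by
  intro hjk
  have h1 := hψ i hi j hj hij
  have h2 := hψ i hi k hk hik
  have h3 := hψ j hj k hk hjk
  revert h1 h2 h3
  cases ψ i <;> cases ψ j <;> cases ψ k <;> simp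

/-- In a bipartite token graph, tokens at distance two lie at the ends of an induced path. -/
theorem IsGuide.eq_of_common_neighbor (hc : IsGuide G c) {i j k : ℕ}
    (hij : TokenAdj G s i j) (hik : TokenAdj G s i k) (hjk : j ≠ k)
    (hn : ¬ TokenAdj G s j k) : c (s j) = c (s k) := by
  have hne : s j ≠ s k := fun h => hn ⟨hjk, Or.inl h⟩
  have hna : ¬ G.Adj (s j) (s k) := fun h => hn ⟨hjk, Or.inr h⟩
  rcases hij.2 with hij | hij
  · exact absurd (hij ▸ hik.2) (not_or.2 ⟨hne, hna⟩)
  rcases hik.2 with hik | hik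
  · exact absurd (hik ▸ hij.symm) hna
  exact hc.ends_eq _ _ _ hij.symm hik hne hna

/-- If one edge of a component of a bipartite token graph joins vertices of different guide
colors, then all of its edges do. -/
theorem IsGuide.ne_of_reachable (hc : IsGuide G c)
    (hψ : ∀ i < n, ∀ j < n, TokenAdj G s i j → ψ i ≠ ψ j) {i j k l : ℕ} (hi : i < n)
    (hj : j < n) (hij : TokenAdj G s i j) (hne : c (s i) ≠ c (s j))
    (hreach : Relation.ReflTransGen (fun a b => a < n ∧ b < n ∧ TokenAdj G s a b) k i)
    (hl : l < n) (hkl : TokenAdj G s k l) : c (s k) ≠ c (s l) := by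
  intro heq
  have step : ∀ a < n, ∀ b < n, ∀ d < n, TokenAdj G s a b → c (s a) = c (s b) →
      TokenAdj G s a d → c (s a) = c (s d) := by
    intro a ha b hb d hd hab h had
    by_cases hbd : b = d
    · exact hbd ▸ h
    · exact h.trans (hc.eq_of_common_neighbor hab had hbd
        (not_tokenAdj_of_common_neighbor hψ ha hb hd hab had))
  have hmono : ∃ m < n, TokenAdj G s i m ∧ c (s i) = c (s m) := by
    clear hij hne hi
    induction hreach with
    | refl => exact ⟨l, hl, hkl, heq⟩
    | tail _ hab ih =>
      obtain ⟨m, hm, ham, h⟩ := ih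
      exact ⟨_, hab.1, hab.2.2.symm, (step _ hab.1 m hm _ hab.2.1 ham h hab.2.2).symm⟩
  obtain ⟨m, hm, him, h⟩ := hmono
  exact hne (step i hi m hm j hj him h hij)

/-- Coloring every isolated new token by the guide, and every other new token differently from
one of its neighbors, yields a proper coloring of a bipartite token graph. -/
theorem IsGuide.proper (hc : IsGuide G c) {col : ℕ → Bool}
    (hcol : ∀ i, (∃ j < i, TokenAdj G s j i ∧ col i = !col j) ∨
      (∀ j < i, ¬ TokenAdj G s j i) ∧ col i = c (s i))
    (hψ : ∀ i < n, ∀ j < n, TokenAdj G s i j → ψ i ≠ ψ j) :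
    ∀ i < n, ∀ j < n, TokenAdj G s i j → col i ≠ col j := by
  induction n with
  | zero => intro i hi; omega
  | succ n ih =>
    have ih := ih fun i hi j hj => hψ i (by omega) j (by omega)
    let r : ℕ → ℕ → Prop := fun a b => a < n ∧ b < n ∧ TokenAdj G s a b
    let r' : ℕ → ℕ → Prop := fun a b => a < n + 1 ∧ b < n + 1 ∧ TokenAdj G s a b
    have hrr' : ∀ a b, r a b → r' a b := fun a b h => ⟨by have := h.1; omega,
      by have := h.2.1; omega, h.2.2⟩
    have hr : Std.Symm r := ⟨fun a b h => ⟨h.2.1, h.1, h.2.2.symm⟩⟩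
    have hsymm : ∀ {a b}, Relation.ReflTransGen r a b → Relation.ReflTransGen r b a :=
      fun h => Relation.ReflTransGen.stdSymm.symm _ _ h
    have hguided : ∀ i < n, ∃ t, Relation.ReflTransGen r t i ∧ col t = c (s t) := by
      intro i
      induction i using Nat.strong_induction_on with
      | _ i ihi =>
      intro hi
      rcases hcol i with ⟨j, hj, hji, -⟩ | ⟨-, h⟩
      · obtain ⟨t, ht, htc⟩ := ihi j hj (by omega)
        exact ⟨t, ht.tail ⟨by omega, hi, hji⟩, htc⟩
      · exact ⟨i, Relation.ReflTransGen.refl, h⟩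
    have hguide : ∀ j < n, ∀ k < n, TokenAdj G s j n → TokenAdj G s k n →
        ¬ Relation.ReflTransGen r j k → (∃ l < n, TokenAdj G s j l) →
        col j = c (s j) ∧ col k = c (s k) ∧ c (s j) = c (s k) := by
      rintro j hj k hk hjn hkn hjk ⟨l, hl, hjl⟩
      have hkj' : k ≠ j := by
        rintro rfl
        exact hjk Relation.ReflTransGen.refl
      have hkl' : k ≠ l := by
        rintro rfl
        exact hjk (Relation.ReflTransGen.single ⟨hj, hl, hjl⟩)
      have hnl' : n ≠ l := by omega
      have hkj : ¬ TokenAdj G s k j := fun h =>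
        hjk (Relation.ReflTransGen.single ⟨hj, hk, h.symm⟩)
      have hkl : ¬ TokenAdj G s k l := fun h =>
        hjk ((Relation.ReflTransGen.single ⟨hj, hl, hjl⟩).tail ⟨hl, hk, h.symm⟩)
      have hnl : ¬ TokenAdj G s n l := not_tokenAdj_of_common_neighbor hψ (i := j) (by omega)
        (by omega) (by omega) hjn hjl
      have hvert : ∀ {a b}, a ≠ b → ¬ TokenAdj G s a b → s a ≠ s b ∧ ¬ G.Adj (s a) (s b) :=
        fun hab h => ⟨fun h' => h ⟨hab, Or.inl h'⟩, fun h' => h ⟨hab, Or.inr h'⟩⟩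
      obtain ⟨kj1, kj2⟩ := hvert hkj' hkj
      obtain ⟨kl1, kl2⟩ := hvert hkl' hkl
      obtain ⟨nl1, nl2⟩ := hvert hnl' hnl
      have hkn' : G.Adj (s k) (s n) := by
        rcases hkn.2 with h | h
        · exact absurd (h ▸ hjn.2) (not_or.2 ⟨kj1.symm, fun h => kj2 h.symm⟩)
        · exact h
      have hnj' : G.Adj (s n) (s j) := by
        rcases hjn.2 with h | h
        · exact absurd (h ▸ hkn.2) (not_or.2 ⟨kj1, kj2⟩)
        · exact h.symm
      have hjl' : G.Adj (s j) (s l) := by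
        rcases hjl.2 with h | h
        · exact absurd (h ▸ hnj') nl2
        · exact h
      have hnj : c (s n) ≠ c (s j) :=
        hc.inner_ne _ _ _ _ hkn' hnj' hjl' kj1 nl1 kj2 nl2 kl2
      have hstep : ∀ a, Relation.ReflTransGen r' a n → ∀ b, r' a b → c (s a) ≠ c (s b) :=
        fun a ha b hab => hc.ne_of_reachable hψ (by omega) (by omega) hjn.symm hnj ha hab.2.1
          hab.2.2
      have hcolc : ∀ m < n, TokenAdj G s m n → col m = c (s m) := by
        intro m hm hmn
        obtain ⟨t, htm, ht⟩ := hguided m hm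
        refine (htm.bool_eq_iff (a := col) (b := fun i => c (s i)) ?_).1 ht
        intro x y htx hxy
        have hxm : Relation.ReflTransGen r x m := (hsymm htx).trans htm
        exact ⟨ih x hxy.1 y hxy.2.1 hxy.2.2, hstep x
          ((Relation.ReflTransGen.mono hrr' _ _ hxm).tail ⟨by omega, by omega, hmn⟩) y
          (hrr' _ _ hxy)⟩
      have hkc := hstep k (Relation.ReflTransGen.single ⟨by omega, by omega, hkn⟩) n
        ⟨by omega, by omega, hkn⟩
      refine ⟨hcolc j hj hjn, hcolc k hk hkn, ?_⟩
      revert hkc hnj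
      cases c (s n) <;> cases c (s j) <;> cases c (s k) <;> simp
    have hsame : ∀ j < n, ∀ k < n, TokenAdj G s j n → TokenAdj G s k n → col j = col k := by
      intro j hj k hk hjn hkn
      by_cases hjk : Relation.ReflTransGen r j k
      · have h := hjk.bool_eq_iff (a := col) (b := ψ) fun x y _ hxy =>
          ⟨ih x hxy.1 y hxy.2.1 hxy.2.2, hψ x (by have := hxy.1; omega) y
            (by have := hxy.2.1; omega) hxy.2.2⟩
        have h1 := hψ j (by omega) n (by omega) hjn
        have h2 := hψ k (by omega) n (by omega) hkn
        revert h h1 h2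
        cases ψ j <;> cases ψ k <;> cases ψ n <;> cases col j <;> cases col k <;> simp
      · by_cases hj' : ∃ l < n, TokenAdj G s j l
        · obtain ⟨h1, h2, h3⟩ := hguide j hj k hk hjn hkn hjk hj'
          rw [h1, h2, h3]
        by_cases hk' : ∃ l < n, TokenAdj G s k l
        · obtain ⟨h1, h2, h3⟩ := hguide k hk j hj hkn hjn (fun h => hjk (hsymm h)) hk'
          rw [h1, h2, h3]
        have hiso : ∀ m < n, (¬ ∃ l < n, TokenAdj G s m l) → col m = c (s m) := by
          intro m hm hiso
          rcases hcol m with ⟨l, hl, hlm, -⟩ | ⟨-, h⟩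
          · exact absurd ⟨l, by omega, hlm.symm⟩ hiso
          · exact h
        rw [hiso j hj hj', hiso k hk hk']
        refine hc.eq_of_common_neighbor hjn.symm hkn.symm ?_ fun h => hj' ⟨k, hk, h⟩
        rintro rfl
        exact hjk Relation.ReflTransGen.refl
    have hlast : ∀ j < n, TokenAdj G s j n → col j ≠ col n := by
      intro j hj hjn
      rcases hcol n with ⟨k, hk, hkn, h⟩ | ⟨h, -⟩
      · rw [h, hsame j hj k hk hjn hkn]
        cases col k <;> simp
      · exact absurd hjn (h j hj)
    intro i hi j hj hij
    rcases Nat.lt_succ_iff_lt_or_eq.1 hi with hi' | hi' <;>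
      rcases Nat.lt_succ_iff_lt_or_eq.1 hj with hj' | hj'
    · exact ih i hi' j hj' hij
    · subst hj'
      exact hlast i hi' hij
    · subst hi'
      exact (hlast j hj' hij.symm).symm
    · exact absurd (hi'.trans hj'.symm) hij.1

end Tokens

open Classical in
/-- The color given to a new token at `x` when the colored tokens in `l` are present: the
opposite of the color of a neighbor if there is one, and the guide color `c x` otherwise. -/
noncomputable def guidedColor {V : Type*} (G : SimpleGraph V) (c : V → Bool)
    (l : List (V × Bool)) (x : V) : Bool :=
  match l.find? fun p => decide (p.1 = x ∨ G.Adj p.1 x) with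
  | some p => !p.2
  | none => c x

/-- The colored tokens, latest first, after the history of moves has been played. -/
noncomputable def guidedState {V : Type*} (G : SimpleGraph V) (c : V → Bool) (h : List V) :
    List (V × Bool) :=
  h.foldl (fun l x => (x, guidedColor G c l x) :: l) []

/-- Algorithm's strategy following the guide `c`. -/
noncomputable def guidedStrategy {V : Type*} (G : SimpleGraph V) (c : V → Bool) (h : List V) :
    ℕ :=
  ((guidedState G c h).head?.elim false Prod.snd).toNat

theorem IsGuide.algWins {V : Type*} {G : SimpleGraph V} {c : V → Bool} (hc : IsGuide G c) :
    AlgWins G 2 2 (guidedStrategy G c) := by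
  intro n s hs
  obtain ⟨ψ, hψ⟩ := hs.exists_bool
  let state : ℕ → List (V × Bool) := fun i => guidedState G c (List.ofFn fun j : Fin i => s j)
  let col : ℕ → Bool := fun i => guidedColor G c (state i) (s i)
  have hsucc : ∀ i, state (i + 1) = (s i, col i) :: state i := by
    intro i
    simp only [state, col, List.ofFn_succ_last, guidedState, List.foldl_append]
    simp
  have hmem : ∀ i p, p ∈ state i ↔ ∃ j < i, p = (s j, col j) := by
    intro i p
    induction i with
    | zero => simp [state, guidedState]
    | succ i ih =>
      rw [hsucc, List.mem_cons, ih]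
      constructor
      · rintro (rfl | ⟨j, hj, rfl⟩)
        exacts [⟨i, by omega, rfl⟩, ⟨j, by omega, rfl⟩]
      · rintro ⟨j, hj, rfl⟩
        rcases (by omega : j < i ∨ j = i) with hj | rfl
        exacts [Or.inr ⟨j, hj, rfl⟩, Or.inl rfl]
  have hcolor : ∀ i, colorOf (guidedStrategy G c) s i = (col i).toNat := by
    intro i
    have h : colorOf (guidedStrategy G c) s i =
      ((state (i + 1)).head?.elim false Prod.snd).toNat := rfl
    rw [h, hsucc]
    rfl
  have hcol : ∀ i, (∃ j < i, TokenAdj G s j i ∧ col i = !col j) ∨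
      (∀ j < i, ¬ TokenAdj G s j i) ∧ col i = c (s i) := by
    intro i
    have hdef : col i = guidedColor G c (state i) (s i) := rfl
    unfold guidedColor at hdef
    split at hdef
    next p hp =>
      obtain ⟨j, hj, rfl⟩ := (hmem i p).1 (List.mem_of_find?_eq_some hp)
      exact Or.inl ⟨j, hj, ⟨hj.ne, by simpa using List.find?_some hp⟩, hdef⟩
    next hp =>
      rw [List.find?_eq_none] at hp
      refine Or.inr ⟨fun j hj hji => ?_, hdef⟩
      exact hp (s j, col j) ((hmem i _).2 ⟨j, hj, rfl⟩) (by simpa using hji.2)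
  refine ⟨fun i _ => ?_, fun i j hi hj hij => ?_⟩
  · rw [hcolor]
    exact Bool.toNat_lt _
  · rw [hcolor, hcolor]
    have hne := hc.proper hcol hψ i hi j hj hij
    revert hne
    cases col i <;> cases col j <;> simp

/-- For a finite graph `G`, one has `f(2, G) = 2` if and only if `G` contains no induced
copy of an odd cycle `Cₙ` with `n ≥ 5`, of `C₅⁺`, of `P₅²`, or of the bull graph. -/
theorem gameValue_two_iff_no_obstruction {V : Type} [Fintype V] [Nonempty V]
    (G : SimpleGraph V) :
    gameValue G 2 = 2 ↔ ¬ HasObstruction G := by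
  rw [gameValue_two_iff_exists_algWins]
  constructor
  · rintro ⟨σ, hσ⟩ hobs
    exact hobs.not_algWins σ hσ
  · intro hobs
    obtain ⟨c, hc⟩ := exists_isGuide hobs
    exact ⟨_, hc.algWins⟩
end
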